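/- Let (A, J) be a flip pair over a finite set 𝒜. Then for every positive integer m, p_{2m, 1}(σ_A, φ_{J,A}) = Δ_{JA}ᵀ A^{m-1} Δ_{AJ}, where Δ_M denotes the column vector of diagonal entries of a square matrix M. (Theorem 3.3, third formula.) -/

import Mathlib

open Matrix

/-- A zero-one integer matrix. -/
def IsZeroOne {α β : Type*} (M : Matrix α β ℤ) : Prop := ∀ a b, M a b = 0 ∨ M a b = 1

/-- A flip pair: a pair `(A, J)` of zero-one square matrices with `AJ = JAᵀ` and `J² = I`. -/
def IsFlipPair {α : Type*} [Fintype α] [DecidableEq α] (A J : Matrix α α ℤ) : Prop :=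
  IsZeroOne A ∧ IsZeroOne J ∧ A * J = J * Aᵀ ∧ J * J = 1

/-- The topological Markov chain `X_A` determined by `A`, as a subtype of `ℤ → α`
(which carries the product topology when `α` is a topological space). -/
abbrev SFT {α : Type*} (A : Matrix α α ℤ) :=
  {x : ℤ → α // ∀ i : ℤ, A (x i) (x (i + 1)) = 1}

/-- The shift map `σ_A` on `X_A`, as a bijection: `σ_A(x)_i = x_{i+1}`. -/
def shiftEquiv {α : Type*} (A : Matrix α α ℤ) : Equiv.Perm (SFT A) where
  toFun x := ⟨fun i => x.1 (i + 1), fun i => x.2 (i + 1)⟩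
  invFun x := ⟨fun i => x.1 (i - 1), fun i => by
    have h := x.2 (i - 1); rwa [show i - 1 + 1 = i + 1 - 1 by ring] at h⟩
  left_inv x := Subtype.ext (funext fun i => by
    show x.1 (i - 1 + 1) = x.1 i
    norm_num)
  right_inv x := Subtype.ext (funext fun i => by
    show x.1 (i + 1 - 1) = x.1 i
    norm_num)

/-- `pFix T m = p_m(T)`: the number of points fixed by `T^m`. -/
noncomputable def pFix {X : Type*} (T : Equiv.Perm X) (m : ℕ) : ℕ :=
  Nat.card {x : X // (T ^ m) x = x}

/-- `pFlip T φ m n = p_{m,n}(T, φ)`: the number of points fixed by both `T^m` and `T^n ∘ φ`. -/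
noncomputable def pFlip {X : Type*} (T : Equiv.Perm X) (φ : X → X) (m : ℕ) (n : ℤ) : ℕ :=
  Nat.card {x : X // (T ^ m) x = x ∧ (T ^ n) (φ x) = x}

theorem shiftEquiv_pow_apply {α : Type*} (A : Matrix α α ℤ) (n : ℕ) (x : SFT A) (i : ℤ) :
    ((shiftEquiv A ^ n) x).1 i = x.1 (i + n) := by
  induction n generalizing x with
  | zero => simp
  | succ n ih =>
    rw [pow_succ, Equiv.Perm.mul_apply, ih]
    change x.1 (i + n + 1) = _
    push_cast
    rw [add_assoc]

/-- Expansion of the bilinear form of a matrix power as a sum over paths. -/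
theorem dotProduct_pow_mulVec_eq_sum {α : Type*} [Fintype α] [DecidableEq α]
    (A : Matrix α α ℤ) (u v : α → ℤ) (n : ℕ) :
    u ⬝ᵥ (A ^ n).mulVec v = ∑ w : Fin (n + 1) → α,
      u (w 0) * (∏ i : Fin n, A (w i.castSucc) (w i.succ)) * v (w (Fin.last n)) := by
  induction n generalizing u with
  | zero =>
    rw [← (Equiv.funUnique (Fin 1) α).symm.sum_comp]
    simp [dotProduct]
  | succ n ih =>
    rw [pow_succ', ← Matrix.mulVec_mulVec, Matrix.dotProduct_mulVec, ih,
      ← (Fin.consEquiv (fun _ : Fin (n + 2) => α)).sum_comp, Fintype.sum_prod_type,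
      Finset.sum_comm]
    refine Finset.sum_congr rfl fun w _ => ?_
    simp only [Fin.consEquiv_apply, Matrix.vecMul, dotProduct, Finset.sum_mul]
    refine Finset.sum_congr rfl fun a _ => ?_
    rw [Fin.prod_univ_succ, ← Fin.succ_last]
    simp only [Fin.castSucc_zero, Fin.cons_zero, Fin.cons_succ, ← Fin.succ_castSucc]
    ring

theorem IsZeroOne.eq_ite {α β : Type*} {M : Matrix α β ℤ} (h : IsZeroOne M) (a : α) (b : β) :
    M a b = if M a b = 1 then 1 else 0 := by
  rcases h a b with h | h <;> simp [h]

/-- For a zero-one matrix, paths with constrained endpoints are counted by matrix powers. -/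
theorem IsZeroOne.card_paths {α : Type*} [Fintype α] [DecidableEq α]
    {A : Matrix α α ℤ} (hA : IsZeroOne A) (p q : α → Prop) [DecidablePred p] [DecidablePred q]
    (n : ℕ) :
    (Nat.card {w : Fin (n + 1) → α // p (w 0) ∧
      (∀ i : Fin n, A (w i.castSucc) (w i.succ) = 1) ∧ q (w (Fin.last n))} : ℤ) =
      (fun a => if p a then (1 : ℤ) else 0) ⬝ᵥ
        (A ^ n).mulVec (fun a => if q a then (1 : ℤ) else 0) := by
  rw [dotProduct_pow_mulVec_eq_sum, Nat.card_eq_fintype_card, Fintype.card_subtype,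
    ← Finset.sum_boole]
  refine Finset.sum_congr rfl fun w _ => ?_
  have h : (∏ i : Fin n, A (w i.castSucc) (w i.succ)) =
      if ∀ i : Fin n, A (w i.castSucc) (w i.succ) = 1 then 1 else 0 := by
    rw [Finset.prod_congr rfl fun (i : Fin n) _ => hA.eq_ite (w i.castSucc) (w i.succ),
      Finset.prod_ite_zero]
    simp
  rw [h]
  split_ifs <;> simp_all

theorem IsZeroOne.eq_ite_of_iff {α : Type*} [DecidableEq α] {J : Matrix α α ℤ} {τ : α → α}
    (hJ : IsZeroOne J) (hτ : ∀ a b, J a b = 1 ↔ τ a = b) (a b : α) :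
    J a b = if τ a = b then 1 else 0 := by
  rw [hJ.eq_ite a b]
  simp only [hτ]

section

variable {α : Type*} [Fintype α] [DecidableEq α] {A J : Matrix α α ℤ} {τ : α → α}

theorem IsFlipPair.involutive (h : IsFlipPair A J) (hτ : ∀ a b, J a b = 1 ↔ τ a = b) :
    Function.Involutive τ := by
  intro a
  have h1 := congrFun (congrFun h.2.2.2 a) a
  simp only [Matrix.mul_apply, h.2.1.eq_ite_of_iff hτ, Matrix.one_apply_eq, ite_mul, one_mul,
    zero_mul, Finset.sum_ite_eq, Finset.mem_univ, if_true] at h1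
  by_contra hne
  simp [hne] at h1

theorem IsFlipPair.mul_left_apply (h : IsFlipPair A J) (hτ : ∀ a b, J a b = 1 ↔ τ a = b)
    (M : Matrix α α ℤ) (a b : α) : (J * M) a b = M (τ a) b := by
  simp [Matrix.mul_apply, h.2.1.eq_ite_of_iff hτ]

theorem IsFlipPair.mul_right_apply (h : IsFlipPair A J) (hτ : ∀ a b, J a b = 1 ↔ τ a = b)
    (M : Matrix α α ℤ) (a b : α) : (M * J) a b = M a (τ b) := by
  simp [Matrix.mul_apply, h.2.1.eq_ite_of_iff hτ, (h.involutive hτ).eq_iff]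

theorem IsFlipPair.apply_flip (h : IsFlipPair A J) (hτ : ∀ a b, J a b = 1 ↔ τ a = b) (a b : α) :
    A (τ b) (τ a) = A a b := by
  have h1 := congrFun (congrFun h.2.2.1 a) (τ b)
  rw [h.mul_right_apply hτ, h.mul_left_apply hτ, Matrix.transpose_apply, h.involutive hτ] at h1
  exact h1.symm

end

/-- The `2 * (n + 1)`-periodic sequence whose period is `w` followed by the reversal of `w`
with `τ` applied. -/
def reflectExtend {α : Type*} (τ : α → α) {n : ℕ} (w : Fin (n + 1) → α) (k : ℤ) : α :=
  if k % (2 * (n + 1)) < n + 1 then w (Fin.ofNat (n + 1) (k % (2 * (n + 1))).toNat)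
  else τ (w (Fin.ofNat (n + 1) (2 * n + 1 - k % (2 * (n + 1))).toNat))

section

variable {α : Type*} {τ : α → α} {n : ℕ} {w : Fin (n + 1) → α}

theorem reflectExtend_of_lt {k : ℤ} {j : ℕ} (hj : j < n + 1) (h : k % (2 * (n + 1)) = j) :
    reflectExtend τ w k = w ⟨j, hj⟩ := by
  unfold reflectExtend
  rw [if_pos (by omega), h]
  congr 1
  ext
  simp [Nat.mod_eq_of_lt hj]

theorem reflectExtend_of_ge {k : ℤ} {j : ℕ} (hj : j < n + 1)
    (h : k % (2 * (n + 1)) = 2 * n + 1 - j) :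
    reflectExtend τ w k = τ (w ⟨j, hj⟩) := by
  unfold reflectExtend
  rw [if_neg (by omega), h]
  congr 2
  ext
  simp [Nat.mod_eq_of_lt hj]

theorem exists_lt_emod_eq (n : ℕ) (k : ℤ) : ∃ j : ℕ, j < n + 1 ∧
    (k % (2 * (n + 1)) = j ∨ k % (2 * (n + 1)) = 2 * n + 1 - j) := by
  have h0 : 0 ≤ k % (2 * ((n : ℤ) + 1)) := Int.emod_nonneg _ (by omega)
  have h1 : k % (2 * ((n : ℤ) + 1)) < 2 * (n + 1) := Int.emod_lt_of_pos _ (by omega)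
  by_cases h : k % (2 * ((n : ℤ) + 1)) < n + 1
  · exact ⟨(k % (2 * ((n : ℤ) + 1))).toNat, by omega, by omega⟩
  · exact ⟨(2 * n + 1 - k % (2 * ((n : ℤ) + 1))).toNat, by omega, by omega⟩

theorem emod_eq_of_eq_add {k r q N : ℤ} (h : k = r + N * q) (h0 : 0 ≤ r) (h1 : r < N) :
    k % N = r := by
  rw [h, Int.add_mul_emod_self_left, Int.emod_eq_of_lt h0 h1]

theorem reflectExtend_add_period (k : ℤ) :
    reflectExtend τ w (k + 2 * (n + 1)) = reflectExtend τ w k := by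
  simp [reflectExtend]

theorem reflectExtend_reflect (hτ : Function.Involutive τ) (k : ℤ) :
    τ (reflectExtend τ w (-(k + 1))) = reflectExtend τ w k := by
  obtain ⟨j, hj, h | h⟩ := exists_lt_emod_eq n k
  · have hk := Int.emod_add_mul_ediv k (2 * ((n : ℤ) + 1))
    rw [reflectExtend_of_lt hj h, reflectExtend_of_ge hj
      (emod_eq_of_eq_add (q := -(k / (2 * ((n : ℤ) + 1))) - 1)
        (by linear_combination hk - h) (by omega) (by omega)), hτ]
  · have hk := Int.emod_add_mul_ediv k (2 * ((n : ℤ) + 1))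
    rw [reflectExtend_of_ge hj h, reflectExtend_of_lt hj
      (emod_eq_of_eq_add (q := -(k / (2 * ((n : ℤ) + 1))) - 1)
        (by linear_combination hk - h) (by omega) (by omega))]

theorem reflectExtend_adj {A : Matrix α α ℤ} (hA : ∀ a b, A (τ b) (τ a) = A a b)
    (h0 : A (τ (w 0)) (w 0) = 1) (hw : ∀ i : Fin n, A (w i.castSucc) (w i.succ) = 1)
    (hn : A (w (Fin.last n)) (τ (w (Fin.last n))) = 1) (k : ℤ) :
    A (reflectExtend τ w k) (reflectExtend τ w (k + 1)) = 1 := by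
  have hk := Int.emod_add_mul_ediv k (2 * ((n : ℤ) + 1))
  obtain ⟨j, hj, h | h⟩ := exists_lt_emod_eq n k
  · rw [reflectExtend_of_lt hj h]
    rcases Nat.lt_or_ge j n with hjn | hjn
    · rw [reflectExtend_of_lt (j := j + 1) (by omega)
        (emod_eq_of_eq_add (q := k / (2 * ((n : ℤ) + 1)))
          (by push_cast; linear_combination h - hk) (by omega) (by omega))]
      exact hw ⟨j, hjn⟩
    · obtain rfl : j = n := by omega
      rw [reflectExtend_of_ge hj
        (emod_eq_of_eq_add (q := k / (2 * ((j : ℤ) + 1)))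
          (by linear_combination h - hk) (by omega) (by omega))]
      exact hn
  · rw [reflectExtend_of_ge hj h]
    rcases j with _ | j
    · rw [reflectExtend_of_lt hj
        (emod_eq_of_eq_add (q := k / (2 * ((n : ℤ) + 1)) + 1)
          (by push_cast at h ⊢; linear_combination h - hk) (by omega) (by omega))]
      exact h0
    · rw [reflectExtend_of_ge (j := j) (by omega)
        (emod_eq_of_eq_add (q := k / (2 * ((n : ℤ) + 1)))
          (by push_cast at h; linear_combination h - hk) (by omega) (by omega)), hA]
      exact hw ⟨j, by omega⟩

/-- A sequence with the periodicity and the reflection symmetry of `reflectExtend` is the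
reflection extension of its initial segment. -/
theorem reflectExtend_restrict {x : ℤ → α} (hp : Function.Periodic x (2 * (n + 1)))
    (hr : ∀ k, τ (x (-(k + 1))) = x k) :
    reflectExtend τ (fun i : Fin (n + 1) => x (i : ℕ)) = x := by
  funext k
  have hmod (k : ℤ) : x (k % (2 * ((n : ℤ) + 1))) = x k := by
    have := hp.int_mul (k / (2 * ((n : ℤ) + 1))) (k % (2 * ((n : ℤ) + 1)))
    rw [← this]
    congr 1
    have hk := Int.emod_add_mul_ediv k (2 * ((n : ℤ) + 1))
    simp only [Int.cast_id]
    linear_combination hk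
  obtain ⟨j, hj, h | h⟩ := exists_lt_emod_eq n k
  · rw [reflectExtend_of_lt hj h, ← hmod k, h]
  · rw [reflectExtend_of_ge hj h, ← hmod k, h, ← hr (2 * n + 1 - j), ← hp (-_)]
    congr 2
    ring

end

/-- **Theorem 3.3, third formula.** For a flip pair `(A, J)` and `m ≥ 1`:
`p_{2m,1}(σ_A, φ_{J,A}) = Δ_{JA}ᵀ A^{m-1} Δ_{AJ}`. -/
theorem stmt11 {𝒜 : Type*} [Fintype 𝒜] [DecidableEq 𝒜]
    (A J : Matrix 𝒜 𝒜 ℤ) (hAJ : IsFlipPair A J)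
    (τ : 𝒜 → 𝒜) (hτ : ∀ a b, J a b = 1 ↔ τ a = b)
    (φJ : SFT A → SFT A) (hφJ : ∀ x i, (φJ x).1 i = τ (x.1 (-i)))
    (m : ℕ) (hm : 1 ≤ m) :
    (pFlip (shiftEquiv A) φJ (2 * m) 1 : ℤ)
      = (fun a => (J * A) a a) ⬝ᵥ (A ^ (m - 1)).mulVec (fun a => (A * J) a a) := by
  obtain ⟨n, rfl⟩ : ∃ n, m = n + 1 := ⟨m - 1, by omega⟩
  have hinv := hAJ.involutive hτ
  have hiff (x : SFT A) : ((shiftEquiv A ^ (2 * (n + 1))) x = x ∧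
      (shiftEquiv A ^ (1 : ℤ)) (φJ x) = x) ↔
      Function.Periodic x.1 (2 * (n + 1)) ∧ ∀ k, τ (x.1 (-(k + 1))) = x.1 k := by
    refine and_congr ?_ ?_
    · rw [Subtype.ext_iff, funext_iff]
      simp only [shiftEquiv_pow_apply, Function.Periodic]
      push_cast
      rfl
    · rw [Subtype.ext_iff, funext_iff, zpow_one]
      refine forall_congr' fun k => ?_
      change (φJ x).1 (k + 1) = _ ↔ _
      rw [hφJ]
  simp only [hAJ.mul_left_apply hτ, hAJ.mul_right_apply hτ, Nat.add_sub_cancel]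
  rw [funext fun a => hAJ.1.eq_ite (τ a) a, funext fun a => hAJ.1.eq_ite a (τ a),
    ← hAJ.1.card_paths (fun a => A (τ a) a = 1) (fun a => A a (τ a) = 1)]
  unfold pFlip
  simp only [hiff]
  rw [Nat.cast_inj]
  refine Nat.card_congr
    { toFun x := ⟨fun i => x.1.1 (i : ℕ), ?_, fun i => ?_, ?_⟩
      invFun w := ⟨⟨reflectExtend τ w.1, reflectExtend_adj (hAJ.apply_flip hτ) w.2.1 w.2.2.1
        w.2.2.2⟩, reflectExtend_add_period, reflectExtend_reflect hinv⟩
      left_inv x := ?_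
      right_inv w := ?_ }
  · have h := x.1.2 (-1)
    have h2 := x.2.2 (-1)
    simp only [neg_add_cancel, neg_zero] at h h2
    simpa [h2] using h
  · simpa using x.1.2 i
  · have h := x.1.2 n
    have h2 := x.2.2 (n + 1)
    rw [← x.2.1, show -((n : ℤ) + 1 + 1) + 2 * (n + 1) = n by ring] at h2
    simpa [h2] using h
  · exact Subtype.ext (Subtype.ext (reflectExtend_restrict x.2.1 x.2.2))
  · refine Subtype.ext (funext fun i => ?_)
    exact reflectExtend_of_lt i.2 (Int.emod_eq_of_lt (by omega) (by omega))
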